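/- arXiv:2311.11987 — 2 statements merged into one kernel-verified Lean document; each statement's English description precedes it below -/
import Mathlib

section
/- Let L be a nilpotent symplectic alternating algebra of dimension 2n ≥ 12 over any field with dim Z(L) = 2. Then the nilpotency class of L is at least 7. -/
/-- A symplectic alternating algebra structure on an `F`-vector space `L`:
a nondegenerate alternating bilinear form together with an alternating
bilinear product satisfying `(x·y, z) = (y·z, x)`. -/
structure SAAStruct (F : Type*) [Field F] (L : Type*) [AddCommGroup L] [Module F L] where
  form : L →ₗ[F] L →ₗ[F] F
  mul : L →ₗ[F] L →ₗ[F] L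
  form_alt : ∀ x : L, form x x = 0
  form_nondegen : ∀ x : L, (∀ y : L, form x y = 0) → x = 0
  mul_alt : ∀ x : L, mul x x = 0
  cyclic : ∀ x y z : L, form (mul x y) z = form (mul y z) x

namespace SAAStruct

variable {F : Type*} [Field F] {L : Type*} [AddCommGroup L] [Module F L]

/-- `I` is an ideal of the symplectic alternating algebra `A`. -/
def IsIdealSub (A : SAAStruct F L) (I : Submodule F L) : Prop :=
  ∀ x ∈ I, ∀ y : L, A.mul x y ∈ I

/-- An ascending chain of ideals `⊥ = I 0 ≤ I 1 ≤ ⋯ ≤ I k = ⊤`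
with `I (s+1) · L ⊆ I s`. -/
def CentralChain (A : SAAStruct F L) (I : ℕ → Submodule F L) (k : ℕ) : Prop :=
  I 0 = ⊥ ∧ I k = ⊤ ∧ (∀ s, s < k → I s ≤ I (s + 1)) ∧
  (∀ s, s ≤ k → A.IsIdealSub (I s)) ∧
  (∀ s, s < k → ∀ x ∈ I (s + 1), ∀ y : L, A.mul x y ∈ I s)

/-- `A` is nilpotent if it admits a central chain of ideals. -/
def IsNilpotent (A : SAAStruct F L) : Prop :=
  ∃ (k : ℕ) (I : ℕ → Submodule F L), A.CentralChain I k

/-- The nilpotency class of `A`: the least length of a central chain of ideals. -/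
noncomputable def nilClass (A : SAAStruct F L) : ℕ :=
  sInf {k | ∃ I : ℕ → Submodule F L, A.CentralChain I k}

/-- The center `Z(L) = {x : x·L = 0}`. -/
def center (A : SAAStruct F L) : Submodule F L := LinearMap.ker A.mul

/-- The lower central series, indexed so that `lcs A i` is `L^(i+1)`:
`lcs A 0 = L¹ = L` and `lcs A (i+1) = L^(i+2) = span {u·v : u ∈ L^(i+1), v ∈ L}`. -/
def lcs (A : SAAStruct F L) : ℕ → Submodule F L
  | 0 => ⊤
  | (i + 1) => Submodule.span F {z | ∃ u ∈ A.lcs i, ∃ v : L, z = A.mul u v}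

/-- The upper central series: `ucs A 0 = 0`, `ucs A (i+1) = {x : x·L ⊆ ucs A i}`. -/
def ucs (A : SAAStruct F L) : ℕ → Submodule F L
  | 0 => ⊥
  | (i + 1) =>
    { carrier := {x | ∀ y : L, A.mul x y ∈ A.ucs i}
      add_mem' := by
        intro a b ha hb y
        simpa [map_add, LinearMap.add_apply] using
          Submodule.add_mem _ (ha y) (hb y)
      zero_mem' := by
        intro y
        simp
      smul_mem' := by
        intro c a ha y
        simpa [map_smul, LinearMap.smul_apply] using
          Submodule.smul_mem _ c (ha y) }

/-- The perp `U^⊥ = {x : (x,u) = 0 for all u ∈ U}` of a subspace with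
respect to the alternating form of `A`. -/
def perp (A : SAAStruct F L) (U : Submodule F L) : Submodule F L :=
  { carrier := {x | ∀ u ∈ U, A.form x u = 0}
    add_mem' := by
      intro a b ha hb u hu
      simp [map_add, LinearMap.add_apply, ha u hu, hb u hu]
    zero_mem' := by
      intro u hu
      simp
    smul_mem' := by
      intro c a ha u hu
      simp [map_smul, LinearMap.smul_apply, ha u hu] }

/-- A subspace is isotropic if the form vanishes identically on it. -/
def Isotropic (A : SAAStruct F L) (U : Submodule F L) : Prop :=
  ∀ u ∈ U, ∀ v ∈ U, A.form u v = 0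

/-- A subspace is abelian if the product vanishes identically on it. -/
def AbelianSub (A : SAAStruct F L) (U : Submodule F L) : Prop :=
  ∀ u ∈ U, ∀ v ∈ U, A.mul u v = 0

end SAAStruct

/-- The function `Ω` with `Ω 0 = 0` and `Ω (m+1) = 2 + C(Ω m, 2)`. -/
def OmegaFn : ℕ → ℕ
  | 0 => 0
  | (m + 1) => 2 + Nat.choose (OmegaFn m) 2

/-- The entries of the Gram matrix of a standard (symplectic) basis
`x₁, y₁, x₂, y₂, …` enumerated as `b 0 = x₁, b 1 = y₁, b 2 = x₂, …`. -/
def stdJ (F : Type*) [Field F] {N : ℕ} (i j : Fin N) : F :=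
  if (i : ℕ) % 2 = 0 ∧ (j : ℕ) = (i : ℕ) + 1 then 1
  else if (j : ℕ) % 2 = 0 ∧ (i : ℕ) = (j : ℕ) + 1 then -1
  else 0

namespace SAAStruct

variable {F : Type*} [Field F] {L : Type*} [AddCommGroup L] [Module F L]

theorem mul_swap (A : SAAStruct F L) (x y : L) : A.mul x y = -A.mul y x := by
  have h := A.mul_alt (x + y)
  simp only [map_add, LinearMap.add_apply, A.mul_alt, zero_add, add_zero] at h
  exact eq_neg_of_add_eq_zero_right h

theorem form_swap (A : SAAStruct F L) (x y : L) : A.form x y = -A.form y x := by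
  have h := A.form_alt (x + y)
  simp only [map_add, LinearMap.add_apply, A.form_alt, zero_add, add_zero] at h
  exact eq_neg_of_add_eq_zero_right h

theorem form_mul_right (A : SAAStruct F L) (x u v : L) :
    A.form x (A.mul u v) = A.form (A.mul x v) u := by
  rw [A.form_swap, A.cyclic, A.mul_swap v x, map_neg, LinearMap.neg_apply, neg_neg]

theorem mul_mem_lcs_succ (A : SAAStruct F L) {i : ℕ} {u : L} (hu : u ∈ A.lcs i) (v : L) :
    A.mul u v ∈ A.lcs (i + 1) :=
  Submodule.subset_span ⟨u, hu, v, rfl⟩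

theorem mul_mem_lcs_succ' (A : SAAStruct F L) {i : ℕ} {u : L} (hu : u ∈ A.lcs i) (v : L) :
    A.mul v u ∈ A.lcs (i + 1) := by
  rw [A.mul_swap]
  exact Submodule.neg_mem _ (A.mul_mem_lcs_succ hu v)

theorem lcs_le_of_centralChain (A : SAAStruct F L) {I : ℕ → Submodule F L} {k : ℕ}
    (h : A.CentralChain I k) : ∀ i, A.lcs i ≤ I (k - i)
  | 0 => by simp [h.2.1]
  | i + 1 => by
    have ih := A.lcs_le_of_centralChain h i
    refine Submodule.span_le.2 ?_
    rintro _ ⟨u, hu, v, rfl⟩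
    rcases Nat.lt_or_ge i k with hik | hik
    · refine h.2.2.2.2 (k - (i + 1)) (by omega) u ?_ v
      rw [show k - (i + 1) + 1 = k - i by omega]
      exact ih hu
    · have hu' := ih hu
      rw [Nat.sub_eq_zero_of_le hik, h.1, Submodule.mem_bot] at hu'
      simp [hu']

theorem form_eq_zero_of_mem_lcs (A : SAAStruct F L) {j : ℕ} :
    ∀ {i : ℕ} {x y : L}, A.lcs (i + j) = ⊥ → x ∈ A.lcs i → y ∈ A.lcs j →
      A.form x y = 0 := by
  induction j with
  | zero =>
    intro i x y h hx _
    rw [Nat.add_zero] at h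
    rw [h, Submodule.mem_bot] at hx
    simp [hx]
  | succ j ih =>
    intro i x y h hx hy
    have hle : A.lcs (j + 1) ≤ LinearMap.ker (A.form x) := by
      refine Submodule.span_le.2 ?_
      rintro _ ⟨u, hu, v, rfl⟩
      rw [SetLike.mem_coe, LinearMap.mem_ker, form_mul_right]
      exact ih (by rwa [Nat.add_right_comm]) (A.mul_mem_lcs_succ hx v) hu
    exact hle hy

theorem form_isRefl (A : SAAStruct F L) : LinearMap.BilinForm.IsRefl A.form := by
  intro x y h
  rw [A.form_swap, h, neg_zero]

theorem form_nondegenerate (A : SAAStruct F L) : LinearMap.BilinForm.Nondegenerate A.form :=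
  A.form_isRefl.nondegenerate_iff_separatingLeft.2 A.form_nondegen

theorem orthogonal_lcs_one (A : SAAStruct F L) :
    LinearMap.BilinForm.orthogonal A.form (A.lcs 1) = A.center := by
  ext z
  rw [LinearMap.BilinForm.mem_orthogonal_iff]
  constructor
  · intro h
    refine LinearMap.mem_ker.2 (LinearMap.ext fun v => A.form_nondegen _ fun u => ?_)
    rw [← form_mul_right, A.form_swap,
      h _ (A.mul_mem_lcs_succ (i := 0) (Submodule.mem_top : u ∈ (⊤ : Submodule F L)) v), neg_zero]
  · intro hz y hy
    have hle : A.lcs 1 ≤ LinearMap.ker (A.form z) := by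
      refine Submodule.span_le.2 ?_
      rintro _ ⟨u, -, v, rfl⟩
      rw [SetLike.mem_coe, LinearMap.mem_ker, form_mul_right, LinearMap.mem_ker.1 hz]
      simp
    exact A.form_isRefl _ _ (hle hy)

theorem finrank_lcs_one_add_finrank_center [FiniteDimensional F L] (A : SAAStruct F L) :
    Module.finrank F (A.lcs 1) + Module.finrank F A.center = Module.finrank F L := by
  rw [← orthogonal_lcs_one,
    LinearMap.BilinForm.finrank_orthogonal A.form_nondegenerate]
  have := Submodule.finrank_le (A.lcs 1)
  omega

theorem two_mul_finrank_lcs_le [FiniteDimensional F L] (A : SAAStruct F L) {i : ℕ}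
    (h : A.lcs (i + i) = ⊥) : 2 * Module.finrank F (A.lcs i) ≤ Module.finrank F L := by
  have hle : A.lcs i ≤ LinearMap.BilinForm.orthogonal A.form (A.lcs i) := fun x hx y hy =>
    A.form_eq_zero_of_mem_lcs h hy hx
  have h1 := Submodule.finrank_mono hle
  rw [LinearMap.BilinForm.finrank_orthogonal A.form_nondegenerate] at h1
  have := Submodule.finrank_le (A.lcs i)
  omega

/-- Generators of `L` modulo `L²`. -/
theorem exists_pair_add_mem_lcs_one [FiniteDimensional F L] (A : SAAStruct F L)
    (hZ : Module.finrank F A.center = 2) :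
    ∃ a b : L, ∀ x : L, ∃ α β : F, ∃ x' ∈ A.lcs 1, x = α • a + β • b + x' := by
  obtain ⟨W, hW⟩ := (A.lcs 1).exists_isCompl
  have hW2 : Module.finrank F W = 2 := by
    have h1 := Submodule.finrank_add_eq_of_isCompl hW
    have h2 := A.finrank_lcs_one_add_finrank_center
    omega
  let B := Module.finBasisOfFinrankEq F W hW2
  refine ⟨B 0, B 1, fun x => ?_⟩
  obtain ⟨x', hx', w, hw, rfl⟩ := Submodule.mem_sup.1
    (hW.sup_eq_top ▸ Submodule.mem_top : x ∈ A.lcs 1 ⊔ W)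
  have h := congrArg Subtype.val (B.sum_repr ⟨w, hw⟩)
  rw [Fin.sum_univ_two] at h
  refine ⟨B.repr ⟨w, hw⟩ 0, B.repr ⟨w, hw⟩ 1, x', hx', ?_⟩
  rw [add_comm x']
  exact congrArg (· + x') h.symm

theorem lcs_one_le_of_pair (A : SAAStruct F L) {a b : L}
    (hab : ∀ x : L, ∃ α β : F, ∃ x' ∈ A.lcs 1, x = α • a + β • b + x') :
    A.lcs 1 ≤ Submodule.span F {A.mul a b} ⊔ A.lcs 2 := by
  refine Submodule.span_le.2 ?_
  rintro _ ⟨x, -, y, rfl⟩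
  obtain ⟨α, β, x', hx', rfl⟩ := hab x
  obtain ⟨γ, δ, y', hy', rfl⟩ := hab y
  refine Submodule.mem_sup.2 ⟨(α * δ - β * γ) • A.mul a b,
    Submodule.smul_mem _ _ (Submodule.mem_span_singleton_self _),
    A.mul (α • a + β • b) y' + A.mul x' (γ • a + δ • b + y'),
    Submodule.add_mem _ (A.mul_mem_lcs_succ' hy' _) (A.mul_mem_lcs_succ hx' _), ?_⟩
  simp only [map_add, LinearMap.add_apply, map_smul, LinearMap.smul_apply, A.mul_alt,
    A.mul_swap b a]
  module

theorem lcs_two_le_of_pair (A : SAAStruct F L) {a b : L}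
    (hab : ∀ x : L, ∃ α β : F, ∃ x' ∈ A.lcs 1, x = α • a + β • b + x') :
    A.lcs 2 ≤ Submodule.span F {A.mul (A.mul a b) a, A.mul (A.mul a b) b} ⊔ A.lcs 3 := by
  have h1 : ∀ u ∈ A.lcs 1, ∃ γ : F, ∃ u' ∈ A.lcs 2, u = γ • A.mul a b + u' := by
    intro u hu
    obtain ⟨w, hw, u', hu', rfl⟩ := Submodule.mem_sup.1 (A.lcs_one_le_of_pair hab hu)
    obtain ⟨γ, rfl⟩ := Submodule.mem_span_singleton.1 hw
    exact ⟨γ, u', hu', rfl⟩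
  refine Submodule.span_le.2 ?_
  rintro _ ⟨u, hu, v, rfl⟩
  obtain ⟨γ, u', hu', rfl⟩ := h1 u hu
  obtain ⟨α, β, v', hv', hv⟩ := hab v
  obtain ⟨δ, v'', hv'', rfl⟩ := h1 v' hv'
  refine Submodule.mem_sup.2
    ⟨(γ * α) • A.mul (A.mul a b) a + (γ * β) • A.mul (A.mul a b) b,
      Submodule.mem_span_pair.2 ⟨_, _, rfl⟩,
      A.mul (γ • A.mul a b) v'' + A.mul u' v,
      Submodule.add_mem _ (A.mul_mem_lcs_succ' hv'' _) (A.mul_mem_lcs_succ hu' _), ?_⟩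
  simp only [hv, map_add, LinearMap.add_apply, map_smul, LinearMap.smul_apply, A.mul_alt]
  module

theorem finrank_le_five_add_finrank_lcs_three [FiniteDimensional F L] (A : SAAStruct F L)
    (hZ : Module.finrank F A.center = 2) :
    Module.finrank F L ≤ 5 + Module.finrank F (A.lcs 3) := by
  obtain ⟨a, b, hab⟩ := A.exists_pair_add_mem_lcs_one hZ
  have h0 := A.finrank_lcs_one_add_finrank_center
  have h1 := Submodule.finrank_mono (A.lcs_one_le_of_pair hab)
  have h2 := Submodule.finrank_mono (A.lcs_two_le_of_pair hab)
  have h3 := Submodule.finrank_add_le_finrank_add_finrank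
    (Submodule.span F {A.mul a b}) (A.lcs 2)
  have h4 := Submodule.finrank_add_le_finrank_add_finrank
    (Submodule.span F {A.mul (A.mul a b) a, A.mul (A.mul a b) b}) (A.lcs 3)
  have h5 : Module.finrank F (Submodule.span F {A.mul a b}) ≤ 1 := by
    have h := finrank_span_finset_le_card (R := F) ({A.mul a b} : Finset L)
    rwa [Finset.coe_singleton] at h
  have h6 : Module.finrank F
      (Submodule.span F {A.mul (A.mul a b) a, A.mul (A.mul a b) b}) ≤ 2 := by
    classical
    have h := finrank_span_finset_le_card (R := F)
      ({A.mul (A.mul a b) a, A.mul (A.mul a b) b} : Finset L)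
    simp only [Finset.coe_insert, Finset.coe_singleton] at h
    exact h.trans Finset.card_le_two
  omega

end SAAStruct

/-- a nilpotent SAA of dimension `2n ≥ 12` with 2-dimensional
center has nilpotency class at least 7. -/
theorem stmt1 (F : Type*) [Field F] (L : Type*) [AddCommGroup L] [Module F L]
    [FiniteDimensional F L] (A : SAAStruct F L) (n : ℕ)
    (hn : 6 ≤ n) (hdim : Module.finrank F L = 2 * n)
    (hnil : A.IsNilpotent) (hZ : Module.finrank F A.center = 2) :
    7 ≤ A.nilClass := by
  by_contra! hlt
  obtain ⟨I, hI⟩ : ∃ I : ℕ → Submodule F L, A.CentralChain I A.nilClass := Nat.sInf_mem hnil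
  have h6 : A.lcs (3 + 3) = ⊥ := by
    have h := A.lcs_le_of_centralChain hI 6
    rwa [show A.nilClass - 6 = 0 by omega, hI.1, le_bot_iff] at h
  have h3 := A.two_mul_finrank_lcs_le h6
  have h5 := A.finrank_le_five_add_finrank_lcs_three hZ
  omega
end

section
/- Let L be a nilpotent symplectic alternating algebra. Then for every i ≥ 2, dim Z_i(L) − dim Z_{i−1}(L) ≤ (1/2)·(dim Z_{i−1}(L) − dim Z_{i−2}(L))·(dim Z_{i−1}(L) + dim Z_{i−2}(L) − 1). -/
namespace Submodule

variable {K V M : Type*} [Field K] [AddCommGroup V] [Module K V] [FiniteDimensional K V]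
  [AddCommGroup M] [Module K M]

theorem finrank_map₂_le_mul (B : V →ₗ[K] V →ₗ[K] M) (C D : Submodule K V) :
    Module.finrank K (map₂ B C D) ≤ Module.finrank K C * Module.finrank K D := by
  rw [TensorProduct.map₂_eq_range_lift_comp_mapIncl, ← Module.finrank_tensorProduct]
  exact LinearMap.finrank_range_le _

/-- An alternating product spans at most `C(dim C, 2)` dimensions on a subspace `C`. -/
theorem two_mul_finrank_map₂_self_le [FiniteDimensional K M] (B : V →ₗ[K] V →ₗ[K] M)
    (hB : B.IsAlt) (C : Submodule K V) :
    2 * Module.finrank K (map₂ B C C) ≤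
      Module.finrank K C * (Module.finrank K C - 1) := by
  set c := Module.finrank K C
  let e := Module.finBasis K C
  let f : (Σ j : Fin c, Fin (j : ℕ)) → M :=
    fun p => B (e (Fin.castLE p.1.2.le p.2)) (e p.1)
  have hlt (i j : Fin c) (hij : i < j) : B (e i) (e j) ∈ span K (Set.range f) :=
    subset_span ⟨⟨j, ⟨i, hij⟩⟩, rfl⟩
  have hmem (i j : Fin c) : B (e i) (e j) ∈ span K (Set.range f) := by
    rcases lt_trichotomy i j with h | rfl | h
    · exact hlt i j h
    · simp [hB (e i : V)]
    · rw [← hB.neg]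
      exact neg_mem (hlt j i h)
  have hC : span K (Set.range fun i => (e i : V)) = C := by
    have := congrArg (map C.subtype) e.span_eq
    rwa [map_span, ← Set.range_comp, map_top, range_subtype] at this
  have hle : map₂ B C C ≤ span K (Set.range f) := by
    rw [← hC, map₂_span_span, span_le]
    rintro _ ⟨_, ⟨i, rfl⟩, _, ⟨j, rfl⟩, rfl⟩
    exact hmem i j
  have hcard : Fintype.card (Σ j : Fin c, Fin (j : ℕ)) * 2 = c * (c - 1) := by
    rw [Fintype.card_sigma, ← Finset.sum_range_id_mul_two, ← Fin.sum_univ_eq_sum_range]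
    simp
  have h1 := finrank_mono hle
  have h2 := finrank_range_le_card (R := K) f
  rw [Set.finrank] at h2
  omega

/-- If `P ≤ Q`, then modulo `P · V` the product `Q · V` is an image of
`(Q / P) ∧ (V / P)`, which bounds its dimension. -/
theorem two_mul_finrank_map₂_top_le [FiniteDimensional K M] (B : V →ₗ[K] V →ₗ[K] M)
    (hB : B.IsAlt) {P Q : Submodule K V} (hPQ : P ≤ Q) :
    2 * (Module.finrank K (map₂ B Q ⊤) : ℤ) ≤ 2 * Module.finrank K (map₂ B P ⊤) +
      ((Module.finrank K Q : ℤ) - Module.finrank K P) *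
        (2 * Module.finrank K V - Module.finrank K P - Module.finrank K Q - 1) := by
  obtain ⟨D, hD⟩ := Q.exists_isCompl
  obtain ⟨C, hdisj, hPC⟩ := IsModularLattice.exists_disjoint_and_sup_eq hPQ
  have hle : map₂ B Q ⊤ ≤ map₂ B P ⊤ ⊔ (map₂ B C C ⊔ map₂ B C D) := by
    rw [map₂_le]
    intro q hq v _
    obtain ⟨p, hp, c, hc, rfl⟩ := mem_sup.1 (hPC ▸ hq)
    obtain ⟨q, hq, d, hd, rfl⟩ := mem_sup.1 (hD.sup_eq_top ▸ mem_top (x := v))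
    obtain ⟨p', hp', c', hc', rfl⟩ := mem_sup.1 (hPC ▸ hq)
    have hcp' : B c p' ∈ map₂ B P ⊤ := by
      rw [← hB.neg]
      exact neg_mem (apply_mem_map₂ B hp' mem_top)
    have hsum : B (p + c) (p' + c' + d) = (B p (p' + c' + d) + B c p') + (B c c' + B c d) := by
      simp only [map_add, LinearMap.add_apply]
      abel
    rw [hsum]
    exact add_mem_sup (add_mem (apply_mem_map₂ B hp mem_top) hcp')
      (add_mem_sup (apply_mem_map₂ B hc hc') (apply_mem_map₂ B hc hd))
  have h1 := finrank_mono hle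
  have h2 := finrank_add_le_finrank_add_finrank (map₂ B P ⊤) (map₂ B C C ⊔ map₂ B C D)
  have h3 := finrank_add_le_finrank_add_finrank (map₂ B C C) (map₂ B C D)
  have h4 := two_mul_finrank_map₂_self_le B hB C
  have h5 := finrank_map₂_le_mul B C D
  have h6 := finrank_add_eq_of_isCompl hD
  have h7 := finrank_sup_add_finrank_inf_eq P C
  rw [hPC, hdisj.eq_bot, finrank_bot, add_zero] at h7
  have h8 : ((Module.finrank K C * (Module.finrank K C - 1) : ℕ) : ℤ) =
      Module.finrank K C * (Module.finrank K C - 1) := by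
    cases Module.finrank K C <;> simp
  zify at h1 h2 h3 h4 h5
  rw [← Nat.cast_mul, h8] at h4
  rw [← h6, h7]
  push_cast
  nlinarith

end Submodule

namespace SAAStruct

variable {F : Type*} [Field F] {L : Type*} [AddCommGroup L] [Module F L]

theorem lcs_succ_eq_map₂ (A : SAAStruct F L) (i : ℕ) :
    A.lcs (i + 1) = Submodule.map₂ A.mul (A.lcs i) ⊤ := by
  apply le_antisymm
  · rw [lcs, Submodule.span_le]
    rintro _ ⟨u, hu, v, rfl⟩
    exact Submodule.apply_mem_map₂ _ hu Submodule.mem_top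
  · rw [Submodule.map₂_le]
    exact fun u hu v _ => Submodule.subset_span ⟨u, hu, v, rfl⟩

theorem lcs_succ_le (A : SAAStruct F L) (i : ℕ) : A.lcs (i + 1) ≤ A.lcs i := by
  induction i with
  | zero => exact le_top
  | succ i ih =>
    rw [lcs_succ_eq_map₂ A (i + 1)]
    conv_rhs => rw [lcs_succ_eq_map₂]
    exact Submodule.map₂_le_map₂_left ih

/-- The upper central series is orthogonal to the lower central series. -/
theorem ucs_eq_perp_lcs (A : SAAStruct F L) (i : ℕ) : A.ucs i = A.perp (A.lcs i) := by
  have hform : A.form.IsAlt := A.form_alt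
  have hmul : A.mul.IsAlt := A.mul_alt
  induction i with
  | zero =>
    refine (eq_bot_iff.2 fun x hx => ?_).symm
    exact A.form_nondegen x fun y => hx y Submodule.mem_top
  | succ i ih =>
    have hadj (x y u : L) : A.form (A.mul x y) u = A.form x (A.mul u y) := by
      rw [A.cyclic, ← hmul.neg, map_neg, LinearMap.neg_apply, hform.neg]
    ext x
    change (∀ y, A.mul x y ∈ A.ucs i) ↔ ∀ u ∈ A.lcs (i + 1), A.form x u = 0
    rw [ih]
    constructor
    · intro h
      have : A.lcs (i + 1) ≤ LinearMap.ker (A.form x) := by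
        rw [lcs_succ_eq_map₂, Submodule.map₂_le]
        intro u hu y _
        rw [LinearMap.mem_ker, ← hadj]
        exact h y u hu
      exact this
    · intro h y u hu
      rw [hadj]
      exact h _ (Submodule.subset_span ⟨u, hu, y, rfl⟩)

theorem finrank_perp_add [FiniteDimensional F L] (A : SAAStruct F L) (U : Submodule F L) :
    Module.finrank F (A.perp U) + Module.finrank F U = Module.finrank F L := by
  have hform : A.form.IsAlt := A.form_alt
  have hperp : A.perp U = LinearMap.BilinForm.orthogonal A.form U := by
    ext x
    exact forall₂_congr fun u _ => hform.isRefl.eq_iff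
  have hnd : LinearMap.BilinForm.Nondegenerate A.form :=
    hform.isRefl.nondegenerate_iff_separatingLeft.2 A.form_nondegen
  have := LinearMap.BilinForm.finrank_orthogonal hnd U
  have := U.finrank_le
  rw [hperp]
  omega

theorem finrank_ucs_add_finrank_lcs [FiniteDimensional F L] (A : SAAStruct F L) (i : ℕ) :
    Module.finrank F (A.ucs i) + Module.finrank F (A.lcs i) = Module.finrank F L := by
  rw [ucs_eq_perp_lcs, finrank_perp_add]

end SAAStruct

/-- for a nilpotent SAA, for every `i ≥ 2`,
`dim Z_i − dim Z_{i−1} ≤ (1/2)(dim Z_{i−1} − dim Z_{i−2})(dim Z_{i−1} + dim Z_{i−2} − 1)`.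
(Stated over `ℤ` with the factor `1/2` cleared.) -/
theorem stmt4 (F : Type*) [Field F] (L : Type*) [AddCommGroup L] [Module F L]
    [FiniteDimensional F L] (A : SAAStruct F L) (hnil : A.IsNilpotent) :
    ∀ i : ℕ, 2 ≤ i →
      2 * ((Module.finrank F (A.ucs i) : ℤ) - Module.finrank F (A.ucs (i - 1))) ≤
        ((Module.finrank F (A.ucs (i - 1)) : ℤ) - Module.finrank F (A.ucs (i - 2))) *
          ((Module.finrank F (A.ucs (i - 1)) : ℤ) + Module.finrank F (A.ucs (i - 2)) - 1) := by
  intro i hi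
  obtain ⟨k, rfl⟩ := Nat.exists_eq_add_of_le' hi
  change 2 * ((Module.finrank F (A.ucs (k + 2)) : ℤ) - Module.finrank F (A.ucs (k + 1))) ≤
    ((Module.finrank F (A.ucs (k + 1)) : ℤ) - Module.finrank F (A.ucs k)) *
    ((Module.finrank F (A.ucs (k + 1)) : ℤ) + Module.finrank F (A.ucs k) - 1)
  have key := Submodule.two_mul_finrank_map₂_top_le A.mul A.mul_alt (A.lcs_succ_le k)
  rw [← A.lcs_succ_eq_map₂, ← A.lcs_succ_eq_map₂] at key
  have h0 := A.finrank_ucs_add_finrank_lcs k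
  have h1 := A.finrank_ucs_add_finrank_lcs (k + 1)
  have h2 := A.finrank_ucs_add_finrank_lcs (k + 2)
  zify at h0 h1 h2
  rw [← h0] at h1 h2 key
  have e1 : (Module.finrank F (A.lcs (k + 1)) : ℤ) = Module.finrank F (A.ucs k) +
      Module.finrank F (A.lcs k) - Module.finrank F (A.ucs (k + 1)) := by linarith
  have e2 : (Module.finrank F (A.lcs (k + 2)) : ℤ) = Module.finrank F (A.ucs k) +
      Module.finrank F (A.lcs k) - Module.finrank F (A.ucs (k + 2)) := by linarith
  rw [show k + 1 + 1 = k + 2 from rfl, e1, e2] at key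
  linarith
end
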